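/- Let u = x_i x_j > v = x_r x_s (i < j, r < s) be squarefree monomials of degree 2 in k[x₁,…,xₙ], let Δ be the simplicial complex on [n] with I_Δ = (L(u,v)), let Δ₁ be the full simplex on {1,…,i−1}, and let Δ₂ be the complex of the ideal generated by L(u,v) in k[x_i,…,xₙ]. Assume Δ is not Cohen-Macaulay over k. Then Δ is Buchsbaum if and only if Δ₁ is the empty complex (i.e., i = 1) and Δ₂ is pure. -/

import Mathlib

open Finset

/-- An abstract simplicial complex on the vertex type `V`: a collection of
finite subsets of `V` (the faces) closed under passing to subsets. -/
structure SComplex (V : Type*) where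
  faces : Set (Finset V)
  down_closed : ∀ ⦃F G : Finset V⦄, F ∈ faces → G ⊆ F → G ∈ faces

namespace SComplex

variable {V : Type*} [DecidableEq V]

/-- The vertex set of a simplicial complex. -/
def vertexSet (Δ : SComplex V) : Set V := {v | {v} ∈ Δ.faces}

/-- A facet is a maximal face. -/
def IsFacet (Δ : SComplex V) (F : Finset V) : Prop :=
  F ∈ Δ.faces ∧ ∀ G ∈ Δ.faces, F ⊆ G → F = G

/-- A complex is pure if all of its facets have the same dimension (cardinality). -/
def Pure (Δ : SComplex V) : Prop :=
  ∀ ⦃F G⦄, Δ.IsFacet F → Δ.IsFacet G → F.card = G.card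

/-- One more than the dimension: the largest cardinality of a face of `Δ`.
So `Δ.dimSucc = d` means `Δ` has dimension `d - 1`. -/
noncomputable def dimSucc (Δ : SComplex V) : ℕ :=
  sSup {n | ∃ F ∈ Δ.faces, F.card = n}

/-- The link of a face `F` : `link Δ F = {G ∈ Δ : G ∪ F ∈ Δ, G ∩ F = ∅}`. -/
def link (Δ : SComplex V) (F : Finset V) : SComplex V where
  faces := {G | G ∈ Δ.faces ∧ Disjoint G F ∧ G ∪ F ∈ Δ.faces}
  down_closed := by
    rintro G H ⟨hG, hdis, hGF⟩ hHG
    exact ⟨Δ.down_closed hG hHG, Finset.disjoint_of_subset_left hHG hdis,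
      Δ.down_closed hGF (Finset.union_subset_union_left hHG)⟩

/-- A complex is connected if it has a vertex and any two vertices are joined
by a path of edges (connectivity of the 1-skeleton). -/
def Connected (Δ : SComplex V) : Prop :=
  (∃ v, {v} ∈ Δ.faces) ∧
    ∀ a b : V, {a} ∈ Δ.faces → {b} ∈ Δ.faces →
      Relation.ReflTransGen (fun x y => x ≠ y ∧ ({x, y} : Finset V) ∈ Δ.faces) a b

/-- The join of two simplicial complexes (on disjoint vertex sets):
`Δ₁ ∗ Δ₂ = {F ∪ G : F ∈ Δ₁, G ∈ Δ₂}`. -/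
def join (Δ₁ Δ₂ : SComplex V) : SComplex V where
  faces := {H | ∃ F ∈ Δ₁.faces, ∃ G ∈ Δ₂.faces, H = F ∪ G}
  down_closed := by
    rintro H H' ⟨F, hF, G, hG, rfl⟩ hsub
    refine ⟨H' ∩ F, Δ₁.down_closed hF inter_subset_right,
      H' \ F, Δ₂.down_closed hG ?_, ?_⟩
    · intro x hx
      rcases Finset.mem_sdiff.mp hx with ⟨hx1, hx2⟩
      rcases Finset.mem_union.mp (hsub hx1) with h | h
      · exact absurd h hx2
      · exact h
    · ext x
      by_cases hx : x ∈ F <;>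
        simp only [Finset.mem_union, Finset.mem_inter, Finset.mem_sdiff, hx] <;> tauto

/-- The full simplex on a finite vertex set `W`. -/
def simplexOn (W : Finset V) : SComplex V :=
  ⟨{F | F ⊆ W}, fun _ _ hF hG => hG.trans hF⟩

/-- A shelling of `Δ`: an ordering `l` of all the facets of `Δ` such that each
facet meets the union of the previous ones in a nonempty union of
codimension-one faces of it. -/
def IsShelling (Δ : SComplex V) (l : List (Finset V)) : Prop :=
  l.Nodup ∧ (∀ F, F ∈ l ↔ Δ.IsFacet F) ∧
    ∀ i j : ℕ, j < i → i < l.length →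
      ∃ m, m < i ∧ ∃ v ∈ l[i]!,
        l[i]! ∩ l[j]! ⊆ l[i]! ∩ l[m]! ∧ l[i]! ∩ l[m]! = l[i]!.erase v

/-- A complex is shellable if its facets admit a shelling order. -/
def Shellable (Δ : SComplex V) : Prop := ∃ l, IsShelling Δ l

/-- The reduced homology `H̃₀(Δ; k)` vanishes: every `k`-linear combination of
vertices of `Δ` with coefficient sum zero is a `k`-linear combination of
boundaries of edges of `Δ`. -/
def ReducedH0Vanishes (k : Type*) [Field k] (Δ : SComplex V) : Prop :=
  ∀ f : V →₀ k, (∀ v ∈ f.support, {v} ∈ Δ.faces) → (f.sum fun _ c => c) = 0 →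
    f ∈ Submodule.span k {g : V →₀ k | ∃ a b : V, a ≠ b ∧ ({a, b} : Finset V) ∈ Δ.faces ∧
      g = Finsupp.single a 1 - Finsupp.single b 1}

end SComplex

/-- A commutative ring satisfies Serre's condition `S₂` if for every prime `p`
the localization at `p` contains, inside its maximal ideal, a regular sequence
of length at least `min 2 (dim R_p)`. -/
def RingSerreS2 (R : Type*) [CommRing R] : Prop :=
  ∀ (p : Ideal R) [p.IsPrime],
    ∃ rs : List (Localization.AtPrime p),
      (∀ r ∈ rs, r ∈ IsLocalRing.maximalIdeal (Localization.AtPrime p)) ∧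
      RingTheory.Sequence.IsRegular (Localization.AtPrime p) rs ∧
      min 2 (ringKrullDim (Localization.AtPrime p)) ≤ (rs.length : WithBot ℕ∞)

section GroundSet

/-- The squarefree monomial `∏_{i ∈ S} xᵢ` in the polynomial ring whose
variables are indexed by the ground set `W ⊆ ℕ`. -/
noncomputable def monoW (k : Type*) [CommRing k] (W S : Finset ℕ) :
    MvPolynomial {x // x ∈ W} k :=
  ∏ i ∈ S.subtype (· ∈ W), MvPolynomial.X i

/-- The Stanley–Reisner ideal of a complex `Δ` with ground (vertex) set `W ⊆ ℕ`,
inside the polynomial ring `k[xᵢ : i ∈ W]`: it is generated by the squarefree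
monomials of the non-faces contained in `W`. -/
noncomputable def srIdealW (k : Type*) [CommRing k] (W : Finset ℕ) (Δ : SComplex ℕ) :
    Ideal (MvPolynomial {x // x ∈ W} k) :=
  Ideal.span {p | ∃ F : Finset ℕ, F ⊆ W ∧ F ∉ Δ.faces ∧ p = monoW k W F}

/-- The Stanley–Reisner ring `k[Δ]` of a complex with ground set `W ⊆ ℕ`. -/
abbrev srRingW (k : Type*) [CommRing k] (W : Finset ℕ) (Δ : SComplex ℕ) :=
  MvPolynomial {x // x ∈ W} k ⧸ srIdealW k W Δ

/-- The irrelevant maximal ideal of the Stanley–Reisner ring. -/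
noncomputable def srIrrelevantW (k : Type*) [CommRing k] (W : Finset ℕ)
    (Δ : SComplex ℕ) : Ideal (srRingW k W Δ) :=
  (Ideal.span (Set.range (MvPolynomial.X : {x // x ∈ W} → MvPolynomial {x // x ∈ W} k))).map
    (Ideal.Quotient.mk (srIdealW k W Δ))

/-- `Δ` (a complex with ground set `W ⊆ ℕ`) is Cohen–Macaulay over the field `k`:
the ring `k[Δ]` admits a regular sequence, inside the irrelevant maximal ideal,
whose length equals the Krull dimension of `k[Δ]`. -/
def IsCMW (k : Type*) [Field k] (W : Finset ℕ) (Δ : SComplex ℕ) : Prop :=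
  ∃ rs : List (srRingW k W Δ), (∀ r ∈ rs, r ∈ srIrrelevantW k W Δ) ∧
    RingTheory.Sequence.IsRegular (srRingW k W Δ) rs ∧
    ringKrullDim (srRingW k W Δ) = (rs.length : WithBot ℕ∞)

/-- `Δ` is `CM_t` (Cohen–Macaulay in codimension `t`) over `k`: `Δ` is pure and
`link_Δ(F)` is Cohen–Macaulay over `k` for every face `F` with `#F ≥ t`.
`CM_1` is the Buchsbaum property. -/
def IsCMtW (k : Type*) [Field k] (W : Finset ℕ) (t : ℕ) (Δ : SComplex ℕ) : Prop :=
  Δ.Pure ∧ ∀ F ∈ Δ.faces, t ≤ F.card → IsCMW k W (Δ.link F)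

end GroundSet

section Lex

/-- Comparison of squarefree monomials of the same degree in the lexicographic
order with `x₁ > x₂ > ⋯ > xₙ`, the monomials being identified with their
supports: `u >_lex v` iff the smallest variable index where they differ
belongs to `u`. -/
def lexGT (A B : Finset ℕ) : Prop :=
  ∃ m ∈ A, m ∉ B ∧ ∀ x < m, (x ∈ A ↔ x ∈ B)

/-- `u ≥_lex v` for squarefree monomials identified with their supports. -/
def lexGE (A B : Finset ℕ) : Prop := A = B ∨ lexGT A B

/-- The lexsegment `L(u,v)` of squarefree monomials of degree `d` in
`x₁, …, xₙ`, the monomials being identified with their supports: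
all `S ⊆ [n] = {1, …, n}` with `#S = d` and `u ≥_lex S ≥_lex v`. -/
def lexSegment (n d : ℕ) (U V₀ : Finset ℕ) : Set (Finset ℕ) :=
  {S | S ⊆ Finset.Icc 1 n ∧ S.card = d ∧ lexGE U S ∧ lexGE S V₀}

/-- The ideal of `k[xᵢ : i ∈ W]` generated by the squarefree monomials of the
lexsegment `L(u,v)` (of degree-`d` squarefree monomials in `x₁, …, xₙ`). -/
noncomputable def lexIdealW (k : Type*) [CommRing k] (W : Finset ℕ) (n d : ℕ)
    (U V₀ : Finset ℕ) : Ideal (MvPolynomial {x // x ∈ W} k) :=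
  Ideal.span {p | ∃ S ∈ lexSegment n d U V₀, p = monoW k W S}

end Lex

section RingCM

open RingTheory.Sequence Polynomial
open scoped Pointwise

/-- The ring `R` has a regular sequence inside the ideal `m`, of length its Krull dimension. -/
def RingCM (R : Type*) [CommRing R] (m : Ideal R) : Prop :=
  ∃ rs : List R, (∀ r ∈ rs, r ∈ m) ∧ IsRegular R rs ∧
    ringKrullDim R = (rs.length : WithBot ℕ∞)

lemma RingCM.of_ringEquiv {R S : Type*} [CommRing R] [CommRing S] {m : Ideal R} {m' : Ideal S}
    (h : RingCM R m) (e : R ≃+* S) (hm : ∀ x ∈ m, e x ∈ m') : RingCM S m' := by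
  obtain ⟨rs, h1, h2, h3⟩ := h
  refine ⟨rs.map e, ?_, ?_, ?_⟩
  · simp only [List.mem_map]
    rintro _ ⟨r, hr, rfl⟩
    exact hm r (h1 r hr)
  · refine (AddEquiv.isRegular_congr (e := e.toAddEquiv) ?_).mp h2
    exact List.forall₂_map_right_iff.mpr (List.forall₂_same.mpr fun r _ x => by simp)
  · rw [← ringKrullDim_eq_of_ringEquiv e, h3, List.length_map]

lemma isRegular_X_cons_map_C {R : Type*} [CommRing R] {rs : List R} (h : IsRegular R rs) :
    IsRegular R[X] (X :: rs.map C) := by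
  rw [isRegular_cons_iff]
  refine ⟨fun p q hpq => ?_, ?_⟩
  · simp only [smul_eq_mul] at hpq
    ext n
    simpa using congrArg (fun f : R[X] => f.coeff (n + 1)) hpq
  · let f : R →+ QuotSMulTop (X : R[X]) R[X] :=
      (Submodule.mkQ ((X : R[X]) • (⊤ : Submodule R[X] R[X]))).toAddMonoidHom.comp
        (C : R →+* R[X]).toAddMonoidHom
    have hf : Function.Bijective f := by
      constructor
      · rw [injective_iff_map_eq_zero]
        intro a ha
        have ha' : (C a : R[X]) ∈ (X : R[X]) • (⊤ : Submodule R[X] R[X]) :=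
          (Submodule.Quotient.mk_eq_zero _).mp ha
        obtain ⟨p, -, hp⟩ := (Submodule.mem_smul_pointwise_iff_exists _ _ _).mp ha'
        simpa using (congrArg (fun f : R[X] => f.coeff 0) hp).symm
      · intro y
        obtain ⟨p, rfl⟩ := Submodule.Quotient.mk_surjective _ y
        refine ⟨p.coeff 0, (Submodule.Quotient.eq _).mpr ?_⟩
        refine (Submodule.mem_smul_pointwise_iff_exists _ _ _).mpr ⟨-p.divX, trivial, ?_⟩
        have := p.X_mul_divX_add
        simp only [smul_eq_mul]
        change _ = C (p.coeff 0) - p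
        linear_combination -this
    refine (AddEquiv.isRegular_congr (e := AddEquiv.ofBijective f hf) ?_).mp h
    refine List.forall₂_map_right_iff.mpr (List.forall₂_same.mpr fun r _ x => ?_)
    change f (r • x) = C r • f x
    change Submodule.Quotient.mk (C (r • x)) = C r • Submodule.Quotient.mk (C x)
    rw [← Submodule.Quotient.mk_smul]
    simp

lemma RingCM.polynomial {R : Type*} [CommRing R] [IsNoetherianRing R] {m : Ideal R}
    {m' : Ideal R[X]} (h : RingCM R m) (hX : X ∈ m') (hm : ∀ x ∈ m, C x ∈ m') :
    RingCM R[X] m' := by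
  obtain ⟨rs, h1, h2, h3⟩ := h
  refine ⟨X :: rs.map C, ?_, isRegular_X_cons_map_C h2, ?_⟩
  · simp only [List.mem_cons, List.mem_map]
    rintro _ (rfl | ⟨r, hr, rfl⟩)
    exacts [hX, hm r (h1 r hr)]
  · rw [Polynomial.ringKrullDim_of_isNoetherianRing, h3]
    simp

lemma ringKrullDim_eq_of_isIntegral {R S : Type*} [CommRing R] [CommRing S] [Algebra R S]
    [Algebra.IsIntegral R S] [FaithfulSMul R S] :
    ringKrullDim S = ringKrullDim R := by
  apply le_antisymm
  · exact Order.krullDim_le_of_strictMono (PrimeSpectrum.comap (algebraMap R S))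
      fun P Q h => Ideal.IsIntegral.comap_lt_comap (I := P.asIdeal) (J := Q.asIdeal) h
  · refine iSup_le fun l => ?_
    obtain ⟨P, hP⟩ := Algebra.IsIntegral.comap_surjective R S l.head
    have : P.asIdeal.LiesOver l.head.asIdeal := ⟨by rw [← hP]; rfl⟩
    obtain ⟨L, hL, -⟩ := Ideal.exists_ltSeries_of_hasGoingUp l P.asIdeal
    rw [← hL]
    exact le_iSup (fun L : LTSeries (PrimeSpectrum S) => (L.length : WithBot ℕ∞)) L

lemma RingCM.adjoinRoot {R : Type*} [CommRing R] {m : Ideal R} {f : R[X]} (hf : f.Monic)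
    (hdeg : f.natDegree ≠ 0) {m' : Ideal (AdjoinRoot f)} (h : RingCM R m)
    (hm : ∀ x ∈ m, AdjoinRoot.of f x ∈ m') : RingCM (AdjoinRoot f) m' := by
  obtain ⟨rs, h1, h2, h3⟩ := h
  have : Module.Free R (AdjoinRoot f) := hf.free_adjoinRoot
  have : Module.Finite R (AdjoinRoot f) := hf.finite_adjoinRoot
  have : Nontrivial R := h2.nontrivial
  have : Nontrivial (AdjoinRoot f) := by
    refine nontrivial_of_ne (AdjoinRoot.mk f 1) 0
      (AdjoinRoot.mk_ne_zero_of_natDegree_lt hf one_ne_zero ?_)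
    simpa using Nat.pos_of_ne_zero hdeg
  refine ⟨rs.map (algebraMap R _), ?_, h2.of_faithfullyFlat, ?_⟩
  · simp only [List.mem_map]
    rintro _ ⟨r, hr, rfl⟩
    exact hm r (h1 r hr)
  · rw [ringKrullDim_eq_of_isIntegral (R := R), h3,
      List.length_map]

lemma RingCM.of_polynomial {A R : Type*} [CommRing A] [IsNoetherianRing A] [CommRing R]
    {mA : Ideal A} {mR : Ideal R} (hA : RingCM A mA) (g : A →+* R) (x : R) (φ : R →+* A[X])
    (hg : ∀ a ∈ mA, g a ∈ mR) (hx : x ∈ mR) (hφg : φ.comp g = C) (hφx : φ x = X)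
    (hψφ : ∀ ψ : A[X] →+* R, (∀ a, ψ (C a) = g a) → ψ X = x → ψ.comp φ = RingHom.id R) :
    RingCM R mR := by
  have h := hA.polynomial (m' := mR.comap (eval₂RingHom g x)) (by simpa using hx)
    fun a ha => by simpa using hg a ha
  refine h.of_ringEquiv (RingEquiv.ofRingHom (eval₂RingHom g x) φ (hψφ _ (by simp) (by simp)) ?_)
    fun _ hx => hx
  refine Polynomial.ringHom_ext' ?_ (by simpa using hφx)
  refine RingHom.ext fun a => ?_
  simpa using congrArg (fun h : A →+* _ => h a) hφg

/-- The polynomial `Y² - XY` in the variable `Y` over `A[X]`. -/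
noncomputable def suspensionPoly (A : Type*) [CommRing A] : A[X][X] := X ^ 2 - C X * X

lemma suspensionPoly_monic (A : Type*) [CommRing A] : (suspensionPoly A).Monic :=
  monic_X_pow_sub ((degree_C_mul_X_le _).trans_lt (by norm_num))

lemma natDegree_suspensionPoly (A : Type*) [CommRing A] [Nontrivial A] :
    (suspensionPoly A).natDegree = 2 := by
  rw [suspensionPoly, natDegree_sub_eq_left_of_natDegree_lt, natDegree_X_pow]
  exact (natDegree_C_mul_le _ _).trans_lt (by simp)

lemma root_mul_suspensionPoly (A : Type*) [CommRing A] :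
    AdjoinRoot.root (suspensionPoly A) *
      (AdjoinRoot.root (suspensionPoly A) - AdjoinRoot.of (suspensionPoly A) X) = 0 := by
  have h : eval₂ (AdjoinRoot.of (suspensionPoly A)) (AdjoinRoot.root (suspensionPoly A))
      (X ^ 2 - C X * X) = 0 := AdjoinRoot.eval₂_root (suspensionPoly A)
  simp only [eval₂_sub, eval₂_mul, eval₂_pow, eval₂_X, eval₂_C] at h
  linear_combination h

lemma RingCM.of_suspensionPoly {A R : Type*} [CommRing A] [IsNoetherianRing A] [CommRing R]
    {mA : Ideal A} {mR : Ideal R} (hA : RingCM A mA) (g : A →+* R) (x y : R)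
    (φ : R →+* AdjoinRoot (suspensionPoly A)) (hg : ∀ a ∈ mA, g a ∈ mR) (hx : x ∈ mR)
    (hy : y ∈ mR) (hxy : x * y = 0) (hφg : φ.comp g = (AdjoinRoot.of (suspensionPoly A)).comp C)
    (hφx : φ x = AdjoinRoot.root _) (hφy : φ y = AdjoinRoot.root _ - AdjoinRoot.of _ X)
    (hψφ : ∀ ψ : AdjoinRoot (suspensionPoly A) →+* R, (∀ a, ψ (AdjoinRoot.of _ (C a)) = g a) →
      ψ (AdjoinRoot.root _) = x → ψ (AdjoinRoot.of _ X) = x - y → ψ.comp φ = RingHom.id R) :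
    RingCM R mR := by
  have : Nontrivial A := by
    obtain ⟨rs, -, h, -⟩ := hA
    exact h.nontrivial
  let ψ : AdjoinRoot (suspensionPoly A) →+* R := AdjoinRoot.lift (eval₂RingHom g (x - y)) x (by
    simp only [suspensionPoly, eval₂_sub, eval₂_mul, eval₂_pow, eval₂_X, eval₂_C,
      coe_eval₂RingHom]
    linear_combination hxy)
  have h1 := hA.polynomial (m' := mR.comap (eval₂RingHom g (x - y)))
    (by simpa using sub_mem hx hy) fun a ha => by simpa using hg a ha
  have h2 := h1.adjoinRoot (suspensionPoly_monic A) (by simp [natDegree_suspensionPoly])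
    (m' := mR.comap ψ) fun a ha => by simpa [ψ] using ha
  refine h2.of_ringEquiv (RingEquiv.ofRingHom ψ φ
    (hψφ _ (by simp [ψ]) (by simp [ψ]) (by simp [ψ])) ?_) fun _ hx => hx
  refine AdjoinRoot.ringHom_ext (Polynomial.ringHom_ext' ?_ ?_) (by simpa [ψ] using hφx)
  · refine RingHom.ext fun a => ?_
    simpa [ψ] using congrArg (fun h : A →+* _ => h a) hφg
  · simp [ψ, hφx, hφy]

end RingCM

section StanleyReisner

open MvPolynomial

variable {k : Type*} [Field k] {W : Finset ℕ}

lemma monoW_dvd_monoW {F G : Finset ℕ} (h : F ⊆ G) : monoW k W F ∣ monoW k W G :=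
  Finset.prod_dvd_prod_of_subset _ _ _ fun _ hx => by
    simp only [Finset.mem_subtype] at hx ⊢
    exact h hx

lemma map_monoW_congr {B : Type*} [CommSemiring B] (f g : MvPolynomial {x // x ∈ W} k →+* B)
    {F : Finset ℕ} (h : ∀ v : {x // x ∈ W}, v.1 ∈ F → f (X v) = g (X v)) :
    f (monoW k W F) = g (monoW k W F) := by
  simp only [monoW, map_prod]
  exact Finset.prod_congr rfl fun v hv => h v (Finset.mem_subtype.mp hv)

lemma map_monoW_eq_zero {B : Type*} [CommSemiring B] (f : MvPolynomial {x // x ∈ W} k →+* B)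
    {F : Finset ℕ} (v : {x // x ∈ W}) (hv : v.1 ∈ F) (h : f (X v) = 0) :
    f (monoW k W F) = 0 := by
  simp only [monoW, map_prod]
  exact Finset.prod_eq_zero (Finset.mem_subtype.mpr hv) h

lemma monoW_singleton {a : ℕ} (ha : a ∈ W) : monoW k W {a} = X ⟨a, ha⟩ := by
  rw [monoW, show ({a} : Finset ℕ).subtype (· ∈ W) = {⟨a, ha⟩} by
    ext v; simp [Subtype.ext_iff], Finset.prod_singleton]

lemma monoW_pair {a b : ℕ} (ha : a ∈ W) (hb : b ∈ W) (hab : a ≠ b) :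
    monoW k W {a, b} = X ⟨a, ha⟩ * X ⟨b, hb⟩ := by
  rw [monoW, show ({a, b} : Finset ℕ).subtype (· ∈ W) = {⟨a, ha⟩, ⟨b, hb⟩} by
    ext v; simp [Subtype.ext_iff], Finset.prod_pair (by simpa using hab)]

variable {Δ Γ : SComplex ℕ}

/-- The class of a variable in the Stanley–Reisner ring. -/
noncomputable abbrev srVar (k : Type*) [Field k] {W : Finset ℕ} (Δ : SComplex ℕ)
    (v : {x // x ∈ W}) : srRingW k W Δ :=
  Ideal.Quotient.mk (srIdealW k W Δ) (X v)

lemma mk_monoW_eq_zero {F : Finset ℕ} (hW : F ⊆ W) (hF : F ∉ Δ.faces) :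
    Ideal.Quotient.mk (srIdealW k W Δ) (monoW k W F) = 0 :=
  Ideal.Quotient.eq_zero_iff_mem.mpr (Ideal.subset_span ⟨F, hW, hF, rfl⟩)

lemma srVar_eq_zero (v : {x // x ∈ W}) (hv : {v.1} ∉ Δ.faces) : srVar k Δ v = 0 := by
  have := mk_monoW_eq_zero (k := k) (W := W) (by simp) hv
  rwa [monoW_singleton v.2] at this

/-- The ring homomorphism from a Stanley–Reisner ring induced by a homomorphism from the
polynomial ring that kills the monomials of the non-faces. -/
noncomputable def srLift {B : Type*} [CommRing B] (f : MvPolynomial {x // x ∈ W} k →+* B)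
    (h : ∀ F ⊆ W, F ∉ Δ.faces → f (monoW k W F) = 0) : srRingW k W Δ →+* B :=
  Ideal.Quotient.lift _ f fun p hp => by
    have : srIdealW k W Δ ≤ RingHom.ker f := by
      refine Ideal.span_le.mpr ?_
      rintro _ ⟨F, hW, hF, rfl⟩
      exact h F hW hF
    exact this hp

@[simp]
lemma srLift_mk {B : Type*} [CommRing B] (f : MvPolynomial {x // x ∈ W} k →+* B)
    (h : ∀ F ⊆ W, F ∉ Δ.faces → f (monoW k W F) = 0) (p : MvPolynomial {x // x ∈ W} k) :
    srLift f h (Ideal.Quotient.mk (srIdealW k W Δ) p) = f p := rfl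

lemma srRing_hom_ext {B : Type*} [CommRing B] {f g : srRingW k W Δ →+* B}
    (hC : ∀ c : k, f (Ideal.Quotient.mk _ (C c)) = g (Ideal.Quotient.mk _ (C c)))
    (hX : ∀ v, f (srVar k Δ v) = g (srVar k Δ v)) : f = g :=
  Ideal.Quotient.ringHom_ext (MvPolynomial.ringHom_ext hC hX)

lemma srIrrelevantW_le {I : Ideal (srRingW k W Δ)} (h : ∀ v, srVar k Δ v ∈ I) :
    srIrrelevantW k W Δ ≤ I := by
  rw [srIrrelevantW, Ideal.map_le_iff_le_comap, Ideal.span_le]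
  rintro _ ⟨v, rfl⟩
  exact h v

lemma srVar_mem (v : {x // x ∈ W}) : srVar k Δ v ∈ srIrrelevantW k W Δ :=
  Ideal.mem_map_of_mem _ (Ideal.subset_span ⟨v, rfl⟩)

lemma isCMW_iff : IsCMW k W Δ ↔ RingCM (srRingW k W Δ) (srIrrelevantW k W Δ) := Iff.rfl

lemma srIrrelevantW_ne_top (h : ∅ ∈ Δ.faces) : srIrrelevantW k W Δ ≠ ⊤ := by
  intro ht
  let f : srRingW k W Δ →+* k := srLift constantCoeff fun F hW hF => by
    obtain ⟨v, hv⟩ : F.Nonempty := by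
      rw [Finset.nonempty_iff_ne_empty]; rintro rfl; exact hF h
    exact map_monoW_eq_zero _ ⟨v, hW hv⟩ hv (by simp)
  have hle : srIrrelevantW k W Δ ≤ RingHom.ker f := srIrrelevantW_le fun v => by
    simp [RingHom.mem_ker, f]
  rw [ht] at hle
  have : f 1 = 0 := hle trivial
  simp at this

/-- The homomorphism `k[Γ] → k[Δ]` for a subcomplex-like `Γ` avoiding the vertices in `T`:
variables in `T` go to zero and all other variables to themselves. -/
noncomputable def srInclude (T : Finset ℕ)
    (h : ∀ F ⊆ W, F ∉ Γ.faces → Disjoint F T → F ∉ Δ.faces) : srRingW k W Γ →+* srRingW k W Δ :=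
  srLift (eval₂Hom ((Ideal.Quotient.mk _).comp C)
      fun v => if v.1 ∈ T then 0 else srVar k Δ v) fun F hW hF => by
    by_cases hT : Disjoint F T
    · rw [map_monoW_congr _ (Ideal.Quotient.mk (srIdealW k W Δ)) fun v hv => ?_]
      · exact mk_monoW_eq_zero hW (h F hW hF hT)
      · simp [Finset.disjoint_left.mp hT hv]
    · obtain ⟨v, hv, hv'⟩ := Finset.not_disjoint_iff.mp hT
      exact map_monoW_eq_zero _ ⟨v, hW hv⟩ hv (by simp [hv'])

lemma srInclude_C (T : Finset ℕ) (h : ∀ F ⊆ W, F ∉ Γ.faces → Disjoint F T → F ∉ Δ.faces)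
    (c : k) : srInclude (k := k) T h (Ideal.Quotient.mk _ (C c)) = Ideal.Quotient.mk _ (C c) := by
  simp [srInclude]

lemma srInclude_srVar (T : Finset ℕ) (h : ∀ F ⊆ W, F ∉ Γ.faces → Disjoint F T → F ∉ Δ.faces)
    (v : {x // x ∈ W}) :
    srInclude (k := k) T h (srVar k Γ v) = if v.1 ∈ T then 0 else srVar k Δ v := by
  simp [srInclude]

lemma srInclude_mem (T : Finset ℕ) (h : ∀ F ⊆ W, F ∉ Γ.faces → Disjoint F T → F ∉ Δ.faces)
    {x : srRingW k W Γ} (hx : x ∈ srIrrelevantW k W Γ) :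
    srInclude T h x ∈ srIrrelevantW k W Δ := by
  have : srIrrelevantW k W Γ ≤ (srIrrelevantW k W Δ).comap (srInclude T h) := by
    refine srIrrelevantW_le fun v => ?_
    rw [Ideal.mem_comap, srInclude_srVar]
    split_ifs
    exacts [zero_mem _, srVar_mem v]
  exact this hx

/-- A cone over a Cohen–Macaulay complex is Cohen–Macaulay. -/
lemma IsCMW.cone {a : ℕ} (ha : a ∈ W) (hΓ : {a} ∉ Γ.faces)
    (h : ∀ F, F ∈ Δ.faces ↔ F.erase a ∈ Γ.faces) (hCM : IsCMW k W Γ) : IsCMW k W Δ := by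
  rw [isCMW_iff] at hCM ⊢
  let g : srRingW k W Γ →+* srRingW k W Δ := srInclude {a} fun F _ hF hd => by
    rwa [h, Finset.erase_eq_of_notMem (by simpa using hd)]
  let φ : srRingW k W Δ →+* Polynomial (srRingW k W Γ) :=
    srLift (eval₂Hom (Polynomial.C.comp ((Ideal.Quotient.mk _).comp C))
      fun v => if v.1 = a then Polynomial.X else Polynomial.C (srVar k Γ v)) fun F hW hF => by
    refine zero_dvd_iff.mp ((dvd_of_eq ?_).trans (map_dvd _ (monoW_dvd_monoW (F.erase_subset a))))
    rw [map_monoW_congr _ (Polynomial.C.comp (Ideal.Quotient.mk (srIdealW k W Γ)))]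
    · rw [RingHom.comp_apply, mk_monoW_eq_zero ((F.erase_subset a).trans hW) (mt (h F).mpr hF),
        map_zero]
    · intro v hv
      simp [Finset.ne_of_mem_erase hv]
  refine hCM.of_polynomial g (srVar k Δ ⟨a, ha⟩) φ (fun x hx => ?_) (srVar_mem _) ?_ (by simp [φ])
    fun ψ hψg hψX => ?_
  · exact srInclude_mem _ _ hx
  · refine srRing_hom_ext (fun c => ?_) fun v => ?_
    · simp [φ, g, srInclude_C]
    · by_cases hv : v.1 = a
      · simp [g, srVar_eq_zero (k := k) v (hv ▸ hΓ)]
      · simp [φ, g, hv, srInclude_srVar]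
  · refine srRing_hom_ext (fun c => ?_) fun v => ?_
    · simp [φ, g, hψg, srInclude_C]
    · by_cases hv : v.1 = a
      · obtain rfl : v = ⟨a, ha⟩ := Subtype.ext hv
        simp [hψX, φ]
      · simp [φ, g, hv, hψg, srInclude_srVar]

/-- The suspension of a Cohen–Macaulay complex is Cohen–Macaulay. -/
lemma IsCMW.suspension {a b : ℕ} (ha : a ∈ W) (hb : b ∈ W) (hab : a ≠ b) (hΓa : {a} ∉ Γ.faces)
    (hΓb : {b} ∉ Γ.faces)
    (h : ∀ F, F ∈ Δ.faces ↔ (F.erase a).erase b ∈ Γ.faces ∧ ¬(a ∈ F ∧ b ∈ F))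
    (hCM : IsCMW k W Γ) : IsCMW k W Δ := by
  rw [isCMW_iff] at hCM ⊢
  have hab0 : srVar k Δ ⟨a, ha⟩ * srVar k Δ ⟨b, hb⟩ = 0 := by
    rw [← map_mul, ← monoW_pair ha hb hab]
    refine mk_monoW_eq_zero (by simp [Finset.insert_subset_iff, ha, hb]) ?_
    simp [h]
  let g : srRingW k W Γ →+* srRingW k W Δ := srInclude {a, b} fun F _ hF hd => by
    simp only [Finset.disjoint_insert_right, Finset.disjoint_singleton_right] at hd
    rw [h, Finset.erase_eq_of_notMem hd.1, Finset.erase_eq_of_notMem hd.2]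
    exact fun h => hF h.1
  have hroot := root_mul_suspensionPoly (srRingW k W Γ)
  let φ : srRingW k W Δ →+* AdjoinRoot (suspensionPoly (srRingW k W Γ)) :=
    srLift (eval₂Hom ((AdjoinRoot.of _).comp (Polynomial.C.comp ((Ideal.Quotient.mk _).comp C)))
      fun v => if v.1 = a then AdjoinRoot.root _
        else if v.1 = b then AdjoinRoot.root _ - AdjoinRoot.of _ Polynomial.X
        else AdjoinRoot.of _ (Polynomial.C (srVar k Γ v))) fun F hW hF => by
    by_cases hF' : a ∈ F ∧ b ∈ F
    · refine zero_dvd_iff.mp ((dvd_of_eq ?_).trans (map_dvd _ (monoW_dvd_monoW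
        (show {a, b} ⊆ F by simp [Finset.insert_subset_iff, hF']))))
      rw [monoW_pair ha hb hab]
      simp [hab.symm, hroot]
    · have hs : (F.erase a).erase b ⊆ F := ((F.erase a).erase_subset b).trans (F.erase_subset a)
      refine zero_dvd_iff.mp ((dvd_of_eq ?_).trans (map_dvd _ (monoW_dvd_monoW hs)))
      rw [map_monoW_congr _
        ((AdjoinRoot.of _).comp (Polynomial.C.comp (Ideal.Quotient.mk (srIdealW k W Γ))))]
      · rw [RingHom.comp_apply, RingHom.comp_apply, mk_monoW_eq_zero (hs.trans hW)
          (fun h' => hF ((h F).mpr ⟨h', hF'⟩)), map_zero, map_zero]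
      · intro v hv
        simp only [Finset.mem_erase] at hv
        simp [hv]
  refine hCM.of_suspensionPoly g (srVar k Δ ⟨a, ha⟩) (srVar k Δ ⟨b, hb⟩) φ (fun x hx => ?_)
    (srVar_mem _) (srVar_mem _) hab0 ?_ (by simp [φ]) (by simp [φ, hab.symm])
    fun ψ hψg hψx hψX => ?_
  · exact srInclude_mem _ _ hx
  · refine srRing_hom_ext (fun c => ?_) fun v => ?_
    · simp [φ, g, srInclude_C]
    · by_cases hv : v.1 = a
      · simp [g, srVar_eq_zero (k := k) v (hv ▸ hΓa)]
      · by_cases hv' : v.1 = b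
        · simp [g, srVar_eq_zero (k := k) v (hv' ▸ hΓb)]
        · simp [φ, g, hv, hv', srInclude_srVar]
  · refine srRing_hom_ext (fun c => ?_) fun v => ?_
    · simp [φ, g, hψg, srInclude_C]
    · by_cases hv : v.1 = a
      · obtain rfl : v = ⟨a, ha⟩ := Subtype.ext hv
        simp [hψx, φ]
      · by_cases hv' : v.1 = b
        · obtain rfl : v = ⟨b, hb⟩ := Subtype.ext hv'
          simp [hψx, hψX, φ, hab.symm]
        · simp [φ, g, hv, hv', hψg, srInclude_srVar]

end StanleyReisner

section LowDimension

open MvPolynomial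

variable {k : Type*} [Field k] {W : Finset ℕ} {Γ : SComplex ℕ}

/-- The complex whose only face is the empty set is Cohen–Macaulay. -/
lemma isCMW_of_faces_eq_singleton_empty (h : Γ.faces = {∅}) : IsCMW k W Γ := by
  rw [isCMW_iff]
  have hk : RingCM k (⊥ : Ideal k) :=
    ⟨[], by simp, RingTheory.Sequence.IsRegular.nil k k, by simp⟩
  let g : srRingW k W Γ →+* k := srLift constantCoeff fun F hW hF => by
    obtain ⟨v, hv⟩ : F.Nonempty := by
      rw [Finset.nonempty_iff_ne_empty]; rintro rfl; exact hF (by simp [h])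
    exact map_monoW_eq_zero _ ⟨v, hW hv⟩ hv (by simp)
  refine hk.of_ringEquiv (RingEquiv.ofRingHom ((Ideal.Quotient.mk _).comp C) g ?_ ?_) ?_
  · refine srRing_hom_ext (fun c => by simp [g]) fun v => ?_
    rw [srVar_eq_zero v (by simp [h]), map_zero, map_zero]
  · ext
    simp [g]
  · intro x hx
    rw [Ideal.mem_bot.mp hx, map_zero]
    exact zero_mem _

/-- The restriction of a polynomial to the coordinate axis of a variable. -/
noncomputable def axisHom (k : Type*) [Field k] {W : Finset ℕ} (v : {x // x ∈ W}) :
    MvPolynomial {x // x ∈ W} k →+* Polynomial k :=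
  eval₂Hom Polynomial.C fun w => if w = v then Polynomial.X else 0

lemma coeff_axisHom (v : {x // x ∈ W}) (p : MvPolynomial {x // x ∈ W} k) (e : ℕ) :
    (axisHom k v p).coeff e = p.coeff (Finsupp.single v e) := by
  induction p using MvPolynomial.induction_on generalizing e with
  | C c =>
    simp [axisHom, Polynomial.coeff_C, coeff_C, eq_comm (a := (0 : {x // x ∈ W} →₀ ℕ))]
  | add p q hp hq => rw [map_add, Polynomial.coeff_add, hp, hq, coeff_add]
  | mul_X p w ih =>
    rw [map_mul, coeff_mul_X']
    by_cases hw : w = v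
    · subst hw
      cases e with
      | zero => simp [axisHom]
      | succ e => simp [← ih, axisHom]
    · simp [axisHom, hw, Finsupp.single_eq_of_ne hw]

lemma srVar_mul_srVar_eq_zero (h1 : ∀ F ∈ Γ.faces, F.card ≤ 1) {v w : {x // x ∈ W}}
    (hvw : v ≠ w) : srVar k Γ v * srVar k Γ w = 0 := by
  have hvw' : v.1 ≠ w.1 := fun h => hvw (Subtype.ext h)
  rw [← map_mul, ← monoW_pair v.2 w.2 hvw']
  refine mk_monoW_eq_zero (by simp [Finset.insert_subset_iff]) fun h => ?_
  have := h1 _ h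
  rw [Finset.card_pair hvw'] at this
  omega

lemma axisHom_monoW_eq_zero (v : {x // x ∈ W}) (hv : {v.1} ∈ Γ.faces) {F : Finset ℕ} (hW : F ⊆ W)
    (hF : F ∉ Γ.faces) : axisHom k v (monoW k W F) = 0 := by
  obtain ⟨w, hw, hwv⟩ : ∃ w ∈ F, w ≠ v.1 := by
    by_contra! h
    exact hF (Γ.down_closed hv fun w hw => by simpa using h w hw)
  have hne : (⟨w, hW hw⟩ : {x // x ∈ W}) ≠ v := fun h => hwv (congrArg Subtype.val h)
  exact map_monoW_eq_zero _ ⟨w, hW hw⟩ hw (by simp [axisHom, hne])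

/-- A polynomial vanishing on all the coordinate axes of a nonempty discrete complex vanishes in
its Stanley–Reisner ring. -/
lemma mk_eq_zero_of_axisHom_eq_zero (h1 : ∀ F ∈ Γ.faces, F.card ≤ 1) {v₀ : {x // x ∈ W}}
    (hv₀ : {v₀.1} ∈ Γ.faces) {p : MvPolynomial {x // x ∈ W} k}
    (hp : ∀ v : {x // x ∈ W}, {v.1} ∈ Γ.faces → axisHom k v p = 0) :
    Ideal.Quotient.mk (srIdealW k W Γ) p = 0 := by
  rw [p.as_sum, map_sum]
  refine Finset.sum_eq_zero fun m hm => ?_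
  have hcoeff : ∀ v : {x // x ∈ W}, {v.1} ∈ Γ.faces → m ≠ Finsupp.single v (m v) := by
    intro v hv hmv
    rw [MvPolynomial.mem_support_iff, hmv, ← coeff_axisHom, hp v hv] at hm
    simp at hm
  have hdvd : ∀ s : {x // x ∈ W} →₀ ℕ, s ≤ m → monomial s (1 : k) ∣ monomial m (p.coeff m) :=
    fun s hs => monomial_dvd_monomial.mpr ⟨Or.inr hs, one_dvd _⟩
  obtain ⟨v, hv⟩ : ∃ v, m v ≠ 0 := by
    by_contra! h
    refine hcoeff v₀ hv₀ (Finsupp.ext fun w => ?_)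
    rw [h v₀, h w, Finsupp.single_zero, Finsupp.coe_zero, Pi.zero_apply]
  by_cases hw : ∃ w, w ≠ v ∧ m w ≠ 0
  · obtain ⟨w, hwv, hw⟩ := hw
    have h2 := hdvd (Finsupp.single v 1 + Finsupp.single w 1) fun x => by
      by_cases hxv : x = v
      · subst hxv
        simp [Finsupp.single_eq_of_ne hwv.symm]
        omega
      · by_cases hxw : x = w
        · subst hxw
          simp [Finsupp.single_eq_of_ne hwv]
          omega
        · simp [Finsupp.single_eq_of_ne hxv, Finsupp.single_eq_of_ne hxw]
    refine zero_dvd_iff.mp ((dvd_of_eq ?_).trans (map_dvd _ h2))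
    rw [show monomial (Finsupp.single v 1 + Finsupp.single w 1) (1 : k) = X v * X w by
      simp [X, monomial_mul], map_mul, srVar_mul_srVar_eq_zero h1 hwv.symm]
  · push Not at hw
    have hmv : m = Finsupp.single v (m v) := by
      ext x
      by_cases hx : x = v
      · simp [hx]
      · rw [hw x hx, Finsupp.single_eq_of_ne hx]
    have h2 := hdvd (Finsupp.single v 1) (by
      rw [hmv]; simp only [Finsupp.single_le_single]; omega)
    refine zero_dvd_iff.mp ((dvd_of_eq ?_).trans (map_dvd _ h2))
    exact (srVar_eq_zero v fun h => hcoeff v h hmv).symm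

/-- A zero-dimensional complex is Cohen–Macaulay. -/
lemma isCMW_of_card_le_one (h1 : ∀ F ∈ Γ.faces, F.card ≤ 1) {v₀ : ℕ} (hW : v₀ ∈ W)
    (hv₀ : {v₀} ∈ Γ.faces) : IsCMW k W Γ := by
  rw [isCMW_iff]
  let w₀ : {x // x ∈ W} := ⟨v₀, hW⟩
  let t : srRingW k W Γ := ∑ v, srVar k Γ v
  have htm : t ∈ srIrrelevantW k W Γ := sum_mem fun v _ => srVar_mem v
  have haxis : ∀ v : {x // x ∈ W}, axisHom k v (∑ w, X w) = Polynomial.X := by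
    intro v
    simp [axisHom]
  have hmk : t = Ideal.Quotient.mk (srIdealW k W Γ) (∑ w, X w) := (map_sum _ _ _).symm
  refine ⟨[t], by simpa using htm, ⟨?_, ?_⟩, ?_⟩
  · rw [RingTheory.Sequence.isWeaklyRegular_singleton_iff, isSMulRegular_iff_right_eq_zero_of_smul]
    intro x hx
    obtain ⟨p, rfl⟩ := Ideal.Quotient.mk_surjective x
    rw [smul_eq_mul, hmk, ← map_mul] at hx
    refine mk_eq_zero_of_axisHom_eq_zero h1 (v₀ := w₀) hv₀ fun v hv => ?_
    have := congrArg (srLift (axisHom k v) fun F hW hF => axisHom_monoW_eq_zero v hv hW hF) hx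
    rw [srLift_mk, map_mul, haxis, map_zero] at this
    exact (mul_eq_zero.mp this).resolve_left Polynomial.X_ne_zero
  · intro htop
    refine srIrrelevantW_ne_top (k := k) (W := W) (Γ.down_closed hv₀ (Finset.empty_subset _)) ?_
    rw [eq_top_iff, htop, Ideal.ofList_singleton, Ideal.smul_eq_mul, Ideal.mul_top,
      Ideal.span_singleton_le_iff_mem]
    exact htm
  · let φ : Polynomial k →+* srRingW k W Γ :=
      Polynomial.eval₂RingHom ((Ideal.Quotient.mk _).comp C) t
    algebraize [φ]
    have hinj : Function.Injective φ := by
      let ψ := srLift (axisHom k w₀) fun F hW hF => axisHom_monoW_eq_zero (Γ := Γ) w₀ hv₀ hW hF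
      have hψ : ψ.comp φ = RingHom.id _ := by
        refine Polynomial.ringHom_ext' ?_ ?_
        · ext
          simp [φ, ψ, axisHom]
        · simp only [φ, ψ, RingHom.comp_apply, Polynomial.coe_eval₂RingHom, Polynomial.eval₂_X,
            hmk, srLift_mk, haxis, RingHom.id_apply]
      exact Function.LeftInverse.injective (g := ψ) fun x => congrArg (fun h => h x) hψ
    have : FaithfulSMul (Polynomial k) (srRingW k W Γ) :=
      (faithfulSMul_iff_algebraMap_injective _ _).mpr hinj
    have hint : ∀ v, IsIntegral (Polynomial k) (srVar k Γ v) := fun v => by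
      refine ⟨suspensionPoly k, suspensionPoly_monic k, ?_⟩
      have ht : t * srVar k Γ v = srVar k Γ v ^ 2 := by
        rw [Finset.sum_mul, Finset.sum_eq_single v, sq]
        · exact fun w _ hw => srVar_mul_srVar_eq_zero h1 hw
        · simp
      have hX : algebraMap (Polynomial k) (srRingW k W Γ) Polynomial.X = t := by
        simp [RingHom.algebraMap_toAlgebra, φ]
      simp only [suspensionPoly, Polynomial.eval₂_sub, Polynomial.eval₂_mul,
        Polynomial.eval₂_pow, Polynomial.eval₂_X, Polynomial.eval₂_C, hX, ht, sub_self]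
    have : Algebra.IsIntegral (Polynomial k) (srRingW k W Γ) := by
      refine ⟨fun x => ?_⟩
      obtain ⟨p, rfl⟩ := Ideal.Quotient.mk_surjective x
      induction p using MvPolynomial.induction_on with
      | C c =>
        have := isIntegral_algebraMap (R := Polynomial k) (A := srRingW k W Γ)
          (x := Polynomial.C c)
        simpa [RingHom.algebraMap_toAlgebra, φ] using this
      | add p q hp hq => rw [map_add]; exact hp.add hq
      | mul_X p v hp => rw [map_mul]; exact hp.mul (hint v)
    rw [ringKrullDim_eq_of_isIntegral (R := Polynomial k),
      Polynomial.ringKrullDim_of_isNoetherianRing, ringKrullDim_eq_zero_of_field]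
    simp

/-- A pure complex of dimension at most one is Buchsbaum. -/
lemma isCMtW_one_of_card_le_two {Δ : SComplex ℕ} (hW : ∀ F ∈ Δ.faces, F ⊆ W) (hpure : Δ.Pure)
    (h2 : ∀ F ∈ Δ.faces, F.card ≤ 2) : IsCMtW k W 1 Δ := by
  refine ⟨hpure, fun F hF hcard => ?_⟩
  have h1 : ∀ G ∈ (Δ.link F).faces, G.card ≤ 1 := fun G ⟨_, hdis, hGF⟩ => by
    have := h2 _ hGF
    rw [Finset.card_union_of_disjoint hdis] at this
    omega
  by_cases h : ∃ v, {v} ∈ (Δ.link F).faces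
  · obtain ⟨v, hv⟩ := h
    exact isCMW_of_card_le_one h1 (hW _ hv.1 (by simp)) hv
  · refine isCMW_of_faces_eq_singleton_empty (Set.eq_singleton_iff_unique_mem.mpr ⟨?_, ?_⟩)
    · exact ⟨Δ.down_closed hF (Finset.empty_subset _), by simp, by simpa using hF⟩
    · intro G hG
      by_contra hne
      obtain ⟨v, hv⟩ := Finset.nonempty_iff_ne_empty.mpr hne
      exact h ⟨v, (Δ.link F).down_closed hG (by simpa using hv)⟩

end LowDimension

section FlagComplex

variable {k : Type*} [Field k] {W : Finset ℕ}

lemma monoW_mem_span_iff {A : Set (Finset ℕ)} (hA : ∀ S ∈ A, S ⊆ W) {F : Finset ℕ} :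
    monoW k W F ∈ Ideal.span {p | ∃ S ∈ A, p = monoW k W S} ↔ ∃ S ∈ A, S ⊆ F := by
  refine ⟨fun h => ?_, fun ⟨S, hS, hSF⟩ =>
    Ideal.mem_of_dvd _ (monoW_dvd_monoW hSF) (Ideal.subset_span ⟨S, hS, rfl⟩)⟩
  by_contra! hF
  let f : MvPolynomial {x // x ∈ W} k →+* k :=
    MvPolynomial.eval fun v => if v.1 ∈ F then 1 else 0
  have hle : Ideal.span {p | ∃ S ∈ A, p = monoW k W S} ≤ RingHom.ker f := by
    refine Ideal.span_le.mpr ?_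
    rintro _ ⟨S, hS, rfl⟩
    obtain ⟨v, hv, hvF⟩ := Finset.not_subset.mp (hF S hS)
    exact map_monoW_eq_zero f ⟨v, hA S hS hv⟩ hv (by simp [f, hvF])
  have h0 : f (monoW k W F) = 0 := hle h
  have h1 : f (monoW k W F) = 1 := by
    simp only [monoW, map_prod]
    exact Finset.prod_eq_one fun v hv => by simp [f, Finset.mem_subtype.mp hv]
  exact one_ne_zero (h1.symm.trans h0)

/-- The faces of a complex are determined by any monomial generators of its Stanley–Reisner
ideal. -/
lemma mem_faces_iff_of_srIdealW_eq {Δ : SComplex ℕ} {A : Set (Finset ℕ)} (hA : ∀ S ∈ A, S ⊆ W)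
    (h : srIdealW k W Δ = Ideal.span {p | ∃ S ∈ A, p = monoW k W S}) {F : Finset ℕ}
    (hF : F ⊆ W) : F ∈ Δ.faces ↔ ∀ S ∈ A, ¬S ⊆ F := by
  have h1 := monoW_mem_span_iff (k := k) (F := F) hA
  have h2 := monoW_mem_span_iff (k := k) (W := W) (A := {G | G ⊆ W ∧ G ∉ Δ.faces}) (F := F)
    fun S hS => hS.1
  simp only [Set.mem_ofPred_eq, and_assoc] at h2
  rw [← h, srIdealW, h2] at h1
  rw [← not_iff_not]
  push Not
  rw [← h1]
  exact ⟨fun hn => ⟨F, hF, hn, subset_rfl⟩, fun ⟨G, _, hG, hGF⟩ hn => hG (Δ.down_closed hn hGF)⟩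

lemma lexGE_pair_iff {a b c d : ℕ} (hab : a < b) (hcd : c < d) :
    lexGE {a, b} {c, d} ↔ a < c ∨ a = c ∧ b ≤ d := by
  simp only [lexGE, lexGT, Finset.mem_insert, Finset.mem_singleton]
  constructor
  · rintro (h | ⟨m, hm, hm', hlt⟩)
    · have h1 : a ∈ ({c, d} : Finset ℕ) := by simp [← h]
      have h2 : b ∈ ({c, d} : Finset ℕ) := by simp [← h]
      simp only [Finset.mem_insert, Finset.mem_singleton] at h1 h2
      omega
    · have h1 := hlt c
      have h2 := hlt d
      have h3 := hlt a
      omega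
  · rintro (h | ⟨rfl, h⟩)
    · exact Or.inr ⟨a, by omega, by omega, fun x hx => by omega⟩
    · rcases h.eq_or_lt with rfl | h
      · exact Or.inl rfl
      · exact Or.inr ⟨b, by omega, by omega, fun x hx => by omega⟩

/-- The edges of a lexsegment of quadrics determine the faces of its complex. -/
lemma mem_faces_iff_forall_pair {n i j r s : ℕ} {Δ : SComplex ℕ} (hij : i < j) (hrs : r < s)
    (hΔsub : ∀ F ∈ Δ.faces, F ⊆ Finset.Icc 1 n)
    (hΔ : srIdealW k (Finset.Icc 1 n) Δ = lexIdealW k (Finset.Icc 1 n) n 2 {i, j} {r, s})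
    {F : Finset ℕ} :
    F ∈ Δ.faces ↔ F ⊆ Finset.Icc 1 n ∧ ∀ a ∈ F, ∀ b ∈ F, a < b →
      i < a ∨ i = a ∧ j ≤ b → ¬(a < r ∨ a = r ∧ b ≤ s) := by
  by_cases hF : F ⊆ Finset.Icc 1 n
  swap
  · exact iff_of_false (fun h => hF (hΔsub F h)) fun h => hF h.1
  rw [mem_faces_iff_of_srIdealW_eq (A := lexSegment n 2 {i, j} {r, s}) (fun S hS => hS.1) hΔ hF,
    and_iff_right hF]
  constructor
  · intro h a ha b hb hab h1 h2
    have hsub : {a, b} ⊆ F := Finset.insert_subset ha (Finset.singleton_subset_iff.mpr hb)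
    exact h {a, b} ⟨hsub.trans hF, Finset.card_pair hab.ne, (lexGE_pair_iff hij hab).mpr h1,
      (lexGE_pair_iff hab hrs).mpr h2⟩ hsub
  · rintro h S ⟨-, hcard, h1, h2⟩ hSF
    obtain ⟨a, b, hne, rfl⟩ := Finset.card_eq_two.mp hcard
    wlog hab : a < b generalizing a b
    · exact this b a hne.symm (by rwa [Finset.pair_comm b a]) (by rwa [Finset.pair_comm b a])
        (by rwa [Finset.pair_comm b a]) (by rwa [Finset.pair_comm b a]) (by omega)
    exact h a (hSF (by simp)) b (hSF (by simp)) hab ((lexGE_pair_iff hij hab).mp h1)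
      ((lexGE_pair_iff hab hrs).mp h2)

lemma SComplex.exists_isFacet_superset {Δ : SComplex ℕ} (hW : ∀ F ∈ Δ.faces, F ⊆ W)
    {F : Finset ℕ} (hF : F ∈ Δ.faces) : ∃ G, Δ.IsFacet G ∧ F ⊆ G := by
  have hfin : Δ.faces.Finite := W.powerset.finite_toSet.subset fun G hG => by
    simpa using hW G hG
  obtain ⟨G, hFG, hG⟩ := hfin.exists_le_maximal hF
  exact ⟨G, ⟨hG.prop, fun H hH hGH => hGH.antisymm (hG.le_of_ge hH hGH)⟩, hFG⟩

/-- In a pure complex, every face extends to a face with as many vertices as a given facet. -/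
lemma SComplex.Pure.exists_isFacet_superset {Δ : SComplex ℕ} (hpure : Δ.Pure)
    (hW : ∀ F ∈ Δ.faces, F ⊆ W) {D F : Finset ℕ} (hD : Δ.IsFacet D) (hF : F ∈ Δ.faces) :
    ∃ G ∈ Δ.faces, F ⊆ G ∧ G.card = D.card := by
  obtain ⟨G, hG, hFG⟩ := SComplex.exists_isFacet_superset hW hF
  exact ⟨G, hG.1, hFG, hpure hG hD⟩

/-- The complex with a disjoint pair of minimal non-faces on four vertices, coned over the
remaining vertices, is Cohen–Macaulay. -/
lemma isCMW_of_two_disjoint_pairs {a b c d : ℕ} (hab : a ≠ b) (hcd : c ≠ d)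
    (hdisj : Disjoint ({a, b} : Finset ℕ) {c, d}) (hsub : {a, b, c, d} ⊆ W) {Δ : SComplex ℕ}
    (hΔ : ∀ F, F ∈ Δ.faces ↔ F ⊆ W ∧ ¬(a ∈ F ∧ b ∈ F) ∧ ¬(c ∈ F ∧ d ∈ F)) : IsCMW k W Δ := by
  let K (V : Finset ℕ) : SComplex ℕ :=
    ⟨{F | F ⊆ V ∧ ¬(a ∈ F ∧ b ∈ F) ∧ ¬(c ∈ F ∧ d ∈ F)}, fun F G hF hG =>
      ⟨hG.trans hF.1, fun h => hF.2.1 ⟨hG h.1, hG h.2⟩, fun h => hF.2.2 ⟨hG h.1, hG h.2⟩⟩⟩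
  have hK (V F : Finset ℕ) :
      F ∈ (K V).faces ↔ F ⊆ V ∧ ¬(a ∈ F ∧ b ∈ F) ∧ ¬(c ∈ F ∧ d ∈ F) := Iff.rfl
  simp only [Finset.disjoint_insert_left, Finset.disjoint_singleton_left, Finset.mem_insert,
    Finset.mem_singleton, not_or] at hdisj
  simp only [Finset.insert_subset_iff, Finset.singleton_subset_iff] at hsub
  obtain ⟨ha, hb, hc, hd⟩ := hsub
  obtain ⟨⟨hac, had⟩, hbc, hbd⟩ := hdisj
  have h0 : IsCMW k W (K ∅) := by
    refine isCMW_of_faces_eq_singleton_empty (Set.ext fun F => ?_)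
    rw [hK, Finset.subset_empty, Set.mem_singleton_iff]
    exact ⟨fun h => h.1, fun h => by simp [h]⟩
  have h1 : IsCMW k W (K {a, b}) := by
    refine h0.suspension ha hb hab (by simp [hK]) (by simp [hK]) fun F => ?_
    simp only [hK, Finset.subset_iff, Finset.mem_erase, Finset.mem_insert, Finset.mem_singleton,
      Finset.notMem_empty]
    grind
  have h2 : IsCMW k W (K {a, b, c, d}) := by
    refine h1.suspension hc hd hcd (by simp [hK]; grind) (by simp [hK]; grind) fun F => ?_
    simp only [hK, Finset.subset_iff, Finset.mem_erase, Finset.mem_insert, Finset.mem_singleton]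
    grind
  have h3 : ∀ V ⊆ W \ {a, b, c, d}, IsCMW k W (K ({a, b, c, d} ∪ V)) := by
    intro V
    induction V using Finset.induction_on with
    | empty => simpa using h2
    | insert v V hv ih =>
      intro hV
      rw [Finset.insert_subset_iff, Finset.mem_sdiff] at hV
      refine (ih hV.2).cone hV.1.1 ?_ fun F => ?_
      · simp only [hK, Finset.singleton_subset_iff, Finset.mem_union]
        tauto
      · simp only [hK, Finset.subset_iff, Finset.mem_erase, Finset.mem_insert,
          Finset.mem_singleton, Finset.mem_union]
        grind
  have h4 := h3 _ subset_rfl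
  rw [Finset.union_sdiff_of_subset (by simp [Finset.insert_subset_iff, *])] at h4
  obtain rfl : Δ = K W := by
    cases Δ
    simp only [K, SComplex.mk.injEq]
    exact Set.ext hΔ
  exact h4

/-- A pure complex of a lexsegment of quadrics starting with a multiple of the first variable is
Buchsbaum or Cohen–Macaulay. -/
lemma isCMtW_one_or_isCMW_of_pure {n j r s : ℕ} {Δ : SComplex ℕ} (hrs : r < s)
    (hj : 1 < j) (hjn : j ≤ n) (hr : 1 ≤ r) (hsn : s ≤ n) (huv : 1 < r ∨ 1 = r ∧ j < s)
    (hΔ : ∀ F, F ∈ Δ.faces ↔ F ⊆ Finset.Icc 1 n ∧ ∀ a ∈ F, ∀ b ∈ F, a < b →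
      1 < a ∨ 1 = a ∧ j ≤ b → ¬(a < r ∨ a = r ∧ b ≤ s))
    (hpure : Δ.Pure) : IsCMtW k (Finset.Icc 1 n) 1 Δ ∨ IsCMW k (Finset.Icc 1 n) Δ := by
  have hsub : ∀ F ∈ Δ.faces, F ⊆ Finset.Icc 1 n := fun F hF => ((hΔ F).mp hF).1
  have hpair : ∀ F ∈ Δ.faces, ∀ a ∈ F, ∀ b ∈ F, a < b →
      1 < a ∨ 1 = a ∧ j ≤ b → ¬(a < r ∨ a = r ∧ b ≤ s) := fun F hF => ((hΔ F).mp hF).2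
  have hvertex : ∀ a, 1 ≤ a → a ≤ n → {a} ∈ Δ.faces := fun a h1 hn =>
    (hΔ _).mpr ⟨by simp [h1, hn], by simp⟩
  rcases huv with hr1 | ⟨rfl, hjs⟩
  swap
  · have hD : Δ.IsFacet (Finset.Icc 2 n) := by
      refine ⟨(hΔ _).mpr ⟨Finset.Icc_subset_Icc_left (by omega), fun a ha => ?_⟩,
        fun G hG hDG => hDG.antisymm fun x hx => ?_⟩
      · rw [Finset.mem_Icc] at ha
        omega
      · have hx' := Finset.mem_Icc.mp (hsub G hG hx)
        have := hpair G hG x hx j (hDG (Finset.mem_Icc.mpr ⟨hj, hjn⟩))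
        rw [Finset.mem_Icc]
        omega
    obtain ⟨G, hG, h1G, hcard⟩ := hpure.exists_isFacet_superset hsub hD (hvertex 1 le_rfl (by omega))
    rw [Finset.singleton_subset_iff] at h1G
    have hle : G ⊆ ((Finset.Icc 1 n).erase j).erase s := fun x hx => by
      have := hpair G hG 1 h1G x hx
      have := hsub G hG hx
      simp only [Finset.mem_erase, Finset.mem_Icc] at this ⊢
      omega
    have := Finset.card_le_card hle
    rw [Finset.card_erase_of_mem, Finset.card_erase_of_mem, Nat.card_Icc, hcard,
      Nat.card_Icc] at this
    · omega
    · simp only [Finset.mem_Icc]; omega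
    · simp only [Finset.mem_erase, Finset.mem_Icc]; omega
  have hD : Δ.IsFacet (Finset.Icc (r + 1) n) := by
    refine ⟨(hΔ _).mpr ⟨Finset.Icc_subset_Icc_left (by omega), fun a ha => ?_⟩,
      fun G hG hDG => hDG.antisymm fun x hx => ?_⟩
    · rw [Finset.mem_Icc] at ha
      omega
    · have hx' := Finset.mem_Icc.mp (hsub G hG hx)
      have h1 := hpair G hG x hx s (hDG (Finset.mem_Icc.mpr (by omega)))
      have h2 := hpair G hG x hx n (hDG (Finset.mem_Icc.mpr (by omega)))
      rw [Finset.mem_Icc]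
      omega
  have hext : ∀ F ∈ Δ.faces, ∃ G ∈ Δ.faces, F ⊆ G ∧ G.card = n - r := fun F hF => by
    obtain ⟨G, hG, hFG, hcard⟩ := hpure.exists_isFacet_superset hsub hD hF
    exact ⟨G, hG, hFG, by rw [hcard, Nat.card_Icc]; omega⟩
  by_cases hdim : n - r ≤ 2
  · refine Or.inl (isCMtW_one_of_card_le_two hsub hpure fun F hF => ?_)
    obtain ⟨G, -, hFG, hcard⟩ := hext F hF
    exact (Finset.card_le_card hFG).trans (hcard.le.trans hdim)
  right
  obtain rfl : r = 2 := by
    by_contra hr2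
    obtain ⟨G, hG, h2G, hcard⟩ := hext {2} (hvertex 2 (by omega) (by omega))
    rw [Finset.singleton_subset_iff] at h2G
    have hle : G ⊆ Finset.Icc 1 2 := fun x hx => by
      have := hpair G hG 2 h2G x hx
      have := hsub G hG hx
      simp only [Finset.mem_Icc] at this ⊢
      omega
    have := Finset.card_le_card hle
    rw [Nat.card_Icc] at this
    omega
  have hj2 : j ≠ 2 := by
    rintro rfl
    obtain ⟨G, hG, h1G, hcard⟩ := hext {1} (hvertex 1 le_rfl (by omega))
    rw [Finset.singleton_subset_iff] at h1G
    have hle : G ⊆ {1} := fun x hx => by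
      have := hpair G hG 1 h1G x hx
      have := hsub G hG hx
      simp only [Finset.mem_Icc, Finset.mem_singleton] at this ⊢
      omega
    have := Finset.card_le_card hle
    rw [Finset.card_singleton] at this
    omega
  have h12 : {1, 2} ∈ Δ.faces := by
    refine (hΔ _).mpr ⟨fun x hx => ?_, fun a ha b hb => ?_⟩
    · simp only [Finset.mem_insert, Finset.mem_singleton, Finset.mem_Icc] at hx ⊢
      omega
    · simp only [Finset.mem_insert, Finset.mem_singleton] at ha hb
      omega
  obtain ⟨G, hG, h12G, hcard⟩ := hext _ h12
  rw [Finset.insert_subset_iff, Finset.singleton_subset_iff] at h12G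
  have hle : G ⊆ {1, 2} ∪ Finset.Icc (s + 1) (j - 1) := fun x hx => by
    have := hpair G hG 1 h12G.1 x hx
    have := hpair G hG 2 h12G.2 x hx
    have := hsub G hG hx
    simp only [Finset.mem_union, Finset.mem_insert, Finset.mem_singleton,
      Finset.mem_Icc] at this ⊢
    omega
  have hcard' := (Finset.card_le_card hle).trans (Finset.card_union_le _ _)
  rw [Finset.card_pair (by omega), Nat.card_Icc] at hcard'
  obtain rfl : j = n := by omega
  obtain rfl : s = 3 := by omega
  refine isCMW_of_two_disjoint_pairs (a := 1) (b := j) (c := 2) (d := 3) (by omega) (by omega)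
    ?_ ?_ fun F => ?_
  · simp only [Finset.disjoint_insert_left, Finset.disjoint_singleton_left, Finset.mem_insert,
      Finset.mem_singleton]
    omega
  · simp only [Finset.insert_subset_iff, Finset.singleton_subset_iff, Finset.mem_Icc]
    omega
  · rw [hΔ]
    refine and_congr_right fun hF => ⟨fun h => ⟨fun ⟨h1, h2⟩ => ?_, fun ⟨h1, h2⟩ => ?_⟩,
      fun ⟨h1, h2⟩ a ha b hb hab h3 h4 => ?_⟩
    · have := h _ h1 _ h2
      omega
    · have := h _ h1 _ h2
      omega
    · have hb' := Finset.mem_Icc.mp (hF hb)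
      rcases h3 with h3 | ⟨rfl, h3⟩
      · obtain rfl : a = 2 := by omega
        obtain rfl : b = 3 := by omega
        exact h2 ⟨ha, hb⟩
      · obtain rfl : b = j := by omega
        exact h1 ⟨ha, hb⟩

end FlagComplex

/-- Let `u = xᵢxⱼ > v = xᵣxₛ`, `Δ` the associated lexsegment
complex, `Δ₁` the full simplex on `{1, …, i-1}` and `Δ₂` the complex of the
lexsegment ideal in `k[xᵢ, …, xₙ]`; assume `Δ` is not Cohen–Macaulay over `k`.
Then `Δ` is Buchsbaum iff `Δ₁` is the empty complex (i.e. `i = 1`) and `Δ₂`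
is pure. -/
theorem lexsegment_buchsbaum_iff_join (k : Type*) [Field k] (n i j r s : ℕ) (hij : i < j) (hrs : r < s)
    (hUsub : ({i, j} : Finset ℕ) ⊆ Finset.Icc 1 n)
    (hVsub : ({r, s} : Finset ℕ) ⊆ Finset.Icc 1 n)
    (huv : lexGT {i, j} {r, s})
    (Δ : SComplex ℕ) (hΔsub : ∀ F ∈ Δ.faces, F ⊆ Finset.Icc 1 n)
    (hΔ : srIdealW k (Finset.Icc 1 n) Δ = lexIdealW k (Finset.Icc 1 n) n 2 {i, j} {r, s})
    (Δ₂ : SComplex ℕ) (hΔ₂sub : ∀ F ∈ Δ₂.faces, F ⊆ Finset.Icc i n)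
    (hΔ₂ : srIdealW k (Finset.Icc i n) Δ₂ = lexIdealW k (Finset.Icc i n) n 2 {i, j} {r, s})
    (hNCM : ¬ IsCMW k (Finset.Icc 1 n) Δ) :
    IsCMtW k (Finset.Icc 1 n) 1 Δ ↔
      ((SComplex.simplexOn (Finset.Icc 1 (i - 1)) : SComplex ℕ).faces = {(∅ : Finset ℕ)} ∧
        Δ₂.Pure) := by
  have hfaces := fun F => mem_faces_iff_forall_pair hij hrs hΔsub hΔ (F := F)
  simp only [Finset.insert_subset_iff, Finset.singleton_subset_iff, Finset.mem_Icc] at hUsub hVsub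
  have huv' : i < r ∨ i = r ∧ j < s := by
    obtain ⟨m, hm, hm', hlt⟩ := huv
    simp only [Finset.mem_insert, Finset.mem_singleton] at hm hm' hlt
    have h1 := hlt r
    have h2 := hlt s
    have h3 := hlt i
    omega
  have hΔΔ₂ : i = 1 → Δ = Δ₂ := by
    rintro rfl
    cases Δ; cases Δ₂
    simp only [SComplex.mk.injEq]
    exact Set.ext fun F =>
      (hfaces F).trans (mem_faces_iff_forall_pair hij hrs hΔ₂sub hΔ₂ (F := F)).symm
  constructor
  · intro hB
    obtain rfl : i = 1 := by
      by_contra hi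
      have hcone : ∀ F, F ∈ Δ.faces ↔ F.erase 1 ∈ (Δ.link {1}).faces := fun F => by
        have hF : F.erase 1 ∪ {1} = insert 1 F := by
          ext x
          simp only [Finset.mem_union, Finset.mem_erase, Finset.mem_singleton, Finset.mem_insert]
          tauto
        refine ⟨fun h => ⟨Δ.down_closed h (F.erase_subset 1), by simp, ?_⟩,
          fun h => Δ.down_closed h.2.2 (hF ▸ Finset.subset_insert 1 F)⟩
        rw [hF, hfaces]
        obtain ⟨hFsub, h⟩ := (hfaces F).mp h
        refine ⟨Finset.insert_subset (Finset.mem_Icc.mpr (by omega)) hFsub,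
          fun a ha b hb hab h1 => ?_⟩
        have hb1 : b ≠ 1 := by omega
        have ha1 : a ≠ 1 := by omega
        exact h a (Finset.mem_of_mem_insert_of_ne ha ha1) b
          (Finset.mem_of_mem_insert_of_ne hb hb1) hab h1
      have hone : {1} ∈ Δ.faces :=
        (hfaces _).mpr ⟨Finset.singleton_subset_iff.mpr (Finset.mem_Icc.mpr (by omega)), by simp⟩
      exact hNCM ((hB.2 {1} hone le_rfl).cone (Finset.mem_Icc.mpr (by omega))
        (fun h => by simpa using h.2.1) hcone)
    refine ⟨by ext F; simp [SComplex.simplexOn], ?_⟩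
    exact hΔΔ₂ rfl ▸ hB.1
  · rintro ⟨hΔ₁, hpure⟩
    obtain rfl : i = 1 := by
      have hmem : Finset.Icc 1 (i - 1) ∈ (SComplex.simplexOn (Finset.Icc 1 (i - 1))).faces :=
        subset_rfl (a := Finset.Icc 1 (i - 1))
      rw [hΔ₁, Set.mem_singleton_iff, Finset.Icc_eq_empty_iff] at hmem
      omega
    exact (isCMtW_one_or_isCMW_of_pure hrs hij (by omega) (by omega) (by omega) huv' hfaces
      (hΔΔ₂ rfl ▸ hpure)).resolve_right hNCM
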